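/- arXiv:1812.04050 — 2 statements merged into one kernel-verified Lean document; each statement's English description precedes it below -/
import Mathlib

section
/- Let n be divisible by 6 and let w ∈ {a,b}* be a word with |Sw| = 1 in ℬ_n whose switch count is minimal among all such words. If vb is a prefix of w such that μ(Svb) = μ(Sv) + 1, then Sv ⊆ C or Sv ⊆ −C. -/
/-- The switch count of a word: the number of maximal blocks of consecutive
equal symbols. -/
def swc {σ : Type*} [DecidableEq σ] : List σ → ℕ
  | [] => 0
  | [_] => 1
  | a :: b :: w => (if a = b then 0 else 1) + swc (b :: w)

/-- Transitions of the automaton `ℬ_n` on the positive states `1,…,n`.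
The symbols are booleans: `false` is `a`, `true` is `b`. -/
def BposStep (n : ℕ) (q : ℤ) (s : Bool) : ℤ :=
  if s then
    (if q = 1 then 2 else if q = (n : ℤ) then -((n : ℤ) / 3)
      else if q % 2 = 0 then q - 1 else q + 1)
  else
    (if q = 1 then -1 else if q = (n : ℤ) then -((n : ℤ) / 3)
      else if q % 2 = 0 then q + 1 else q - 1)

/-- Transitions of the auxiliary automaton `ℬ_n`, with state set
`{-n,…,-1} ∪ {1,…,n}` inside `ℤ` and symbols `false` (= `a`), `true` (= `b`);
negative states move symmetrically: `(-q)s = -(qs)`. -/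
def Bstep (n : ℕ) (q : ℤ) (s : Bool) : ℤ :=
  if 0 < q then BposStep n q s else -(BposStep n (-q) s)

/-- The state reached from `q` after reading the word `w` in `ℬ_n`. -/
def Bact (n : ℕ) (q : ℤ) (w : List Bool) : ℤ := w.foldl (Bstep n) q

/-- The image of a set of states of `ℬ_n` under the action of a word. -/
def BactSet (n : ℕ) (A : Set ℤ) (w : List Bool) : Set ℤ :=
  (fun q => Bact n q w) '' A

/-- The set `S = {2k : 1 ≤ k ≤ n/2} ∪ {-(2k-1) : 1 ≤ k ≤ n/2}`. -/
def SetS (n : ℕ) : Set ℤ :=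
  {q | (0 < q ∧ q ≤ (n : ℤ) ∧ q % 2 = 0) ∨ (-(n : ℤ) < q ∧ q < 0 ∧ q % 2 = 1)}

/-- The cycle `C = [-n/3 + 1, n]`, the interval in `S` of states `q` with
`-n/3 + 1 ≤ q ≤ n`. -/
def SetC (n : ℕ) : Set ℤ := {q ∈ SetS n | -((n : ℤ) / 3) + 1 ≤ q}

/-- The action of the word `ab` in `ℬ_n`. -/
def rotAB (n : ℕ) (q : ℤ) : ℤ := Bstep n (Bstep n q false) true

/-- `p ≃ q` iff `p(ab)^{n/3} = q(ab)^{n/3}`. -/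
def simeqB (n : ℕ) (p q : ℤ) : Prop :=
  (rotAB n)^[n / 3] p = (rotAB n)^[n / 3] q

/-- Distance from `p` to `q` for `p, q ∈ S`: the least `k ≥ 1` with
`p(ab)^{n/3 + k} = q(ab)^{n/3}`. -/
noncomputable def dpos (n : ℕ) (p q : ℤ) : ℕ :=
  sInf {k : ℕ | 1 ≤ k ∧ (rotAB n)^[n / 3 + k] p = (rotAB n)^[n / 3] q}

open Classical in
/-- Distance between states of `ℬ_n`: for `p, q ∈ S` it is `dpos`, for
`p, q ∈ -S` it is defined by `d(p,q) = d(-q,-p)`. -/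
noncomputable def dB (n : ℕ) (p q : ℤ) : ℕ :=
  if p ∈ SetS n then dpos n p q else dpos n (-q) (-p)

/-- The measure `μ(A) = max_{p ∈ A} min_{q ∈ A} d(p,q)`. -/
noncomputable def muB (n : ℕ) (A : Set ℤ) : ℕ :=
  sSup ((fun p => sInf ((fun q => dB n p q) '' A)) '' A)

/-- The increasing enumeration of the nonzero integers that are positive and even or
negative and odd; it maps `[1 - n/2, n/2]` onto `SetS n`. -/
def ladder (k : ℤ) : ℤ := if 0 < k then 2 * k else 2 * k - 1

/-- The action of a symbol on `SetS (6 * t)` followed by negation, read through `ladder`: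
a reflection, except that the maximal index `3 * t` is sent to `t`. -/
def flipIdx (t : ℕ) (s : Bool) (k : ℤ) : ℤ :=
  if k = 3 * t then t else (if s then 1 else 0) - k

theorem ladder_ne_zero (k : ℤ) : ladder k ≠ 0 := by
  unfold ladder; split_ifs <;> omega

theorem ladder_injective : Function.Injective ladder := by
  intro k l h
  unfold ladder at h
  split_ifs at h <;> omega

theorem ladder_mem_SetS {t : ℕ} {k : ℤ} (hk : k ∈ Set.Icc (1 - 3 * t : ℤ) (3 * t)) :
    ladder k ∈ SetS (6 * t) := by
  obtain ⟨h1, h2⟩ := hk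
  unfold ladder SetS
  simp only [Set.mem_ofPred_eq]
  push_cast
  split_ifs <;> omega

theorem neg_ladder_notMem_SetS {n : ℕ} (k : ℤ) : -ladder k ∉ SetS n := by
  unfold ladder SetS
  simp only [Set.mem_ofPred_eq]
  split_ifs <;> omega

theorem SetS_eq_image (t : ℕ) :
    SetS (6 * t) = ladder '' Set.Icc (1 - 3 * t : ℤ) (3 * t) := by
  ext q
  constructor
  · intro h
    unfold SetS at h
    simp only [Set.mem_ofPred_eq] at h
    push_cast at h
    refine ⟨(q + 1) / 2, ⟨by omega, by omega⟩, ?_⟩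
    unfold ladder
    split_ifs <;> omega
  · rintro ⟨k, hk, rfl⟩
    exact ladder_mem_SetS hk

theorem ladder_mem_SetC {t : ℕ} {k : ℤ} (hk : k ∈ Set.Icc (1 - 3 * t : ℤ) (3 * t))
    (h : 1 - (t : ℤ) ≤ k) : ladder k ∈ SetC (6 * t) := by
  refine ⟨ladder_mem_SetS hk, ?_⟩
  unfold ladder
  push_cast
  split_ifs <;> omega

theorem Bstep_neg (n : ℕ) {q : ℤ} (hq : q ≠ 0) (s : Bool) :
    Bstep n (-q) s = -Bstep n q s := by
  unfold Bstep
  rcases lt_or_gt_of_ne hq with h | h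
  · rw [if_pos (by omega), if_neg (by omega), neg_neg]
  · rw [if_neg (by omega), if_pos (by omega), neg_neg]

theorem Bstep_ladder {t : ℕ} (ht : 1 ≤ t) (s : Bool) {k : ℤ}
    (hk : k ∈ Set.Icc (1 - 3 * t : ℤ) (3 * t)) :
    Bstep (6 * t) (ladder k) s = -ladder (flipIdx t s k) := by
  obtain ⟨h1, h2⟩ := hk
  cases s <;> unfold Bstep BposStep ladder flipIdx <;>
    simp only [Bool.false_eq_true, if_true, if_false] <;> push_cast <;>
    split_ifs <;> omega

theorem Bstep_neg_ladder {t : ℕ} (ht : 1 ≤ t) (s : Bool) {k : ℤ}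
    (hk : k ∈ Set.Icc (1 - 3 * t : ℤ) (3 * t)) :
    Bstep (6 * t) (-ladder k) s = ladder (flipIdx t s k) := by
  rw [Bstep_neg _ (ladder_ne_zero k), Bstep_ladder ht s hk, neg_neg]

theorem flipIdx_mem {t : ℕ} (ht : 1 ≤ t) (s : Bool) {k : ℤ}
    (hk : k ∈ Set.Icc (1 - 3 * t : ℤ) (3 * t)) :
    flipIdx t s k ∈ Set.Icc (1 - 3 * t : ℤ) (3 * t) := by
  obtain ⟨h1, h2⟩ := hk
  constructor <;> cases s <;> unfold flipIdx <;> simp <;> split_ifs <;> omega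

theorem rotAB_ladder {t : ℕ} (ht : 1 ≤ t) {k : ℤ}
    (hk : k ∈ Set.Icc (1 - 3 * t : ℤ) (3 * t)) :
    rotAB (6 * t) (ladder k) = ladder (if k = 3 * t then 1 - t else k + 1) := by
  unfold rotAB
  rw [Bstep_ladder ht false hk, Bstep_neg_ladder ht true (flipIdx_mem ht false hk)]
  obtain ⟨h1, h2⟩ := hk
  congr 1
  unfold flipIdx
  simp only [Bool.false_eq_true, if_true, if_false]
  split_ifs <;> omega

theorem rotAB_iterate_ladder {t : ℕ} (ht : 1 ≤ t) {k : ℤ}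
    (hk : k ∈ Set.Icc (1 - 3 * t : ℤ) (3 * t)) (m : ℕ) :
    ∃ j : ℤ, (rotAB (6 * t))^[m] (ladder k) = ladder j ∧ (4 * t : ℤ) ∣ k + m - j ∧
      j ∈ Set.Icc (1 - 3 * t : ℤ) (3 * t) ∧ min (k + m) (1 - t) ≤ j := by
  induction m with
  | zero => exact ⟨k, rfl, by simp, hk, by simp⟩
  | succ m ih =>
    obtain ⟨j, hj, hd, hm, hle⟩ := ih
    refine ⟨if j = 3 * t then 1 - t else j + 1, ?_, ?_, ?_, ?_⟩
    · rw [Function.iterate_succ_apply', hj, rotAB_ladder ht hm]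
    · obtain ⟨c, hc⟩ := hd
      split_ifs with h
      · exact ⟨c + 1, by push_cast; linarith⟩
      · exact ⟨c, by push_cast; linarith⟩
    · obtain ⟨h1, h2⟩ := hm
      constructor <;> split_ifs <;> omega
    · push_cast
      split_ifs <;> omega

theorem rotAB_iterate_eq_iff {t : ℕ} (ht : 1 ≤ t) {k l : ℤ}
    (hk : k ∈ Set.Icc (1 - 3 * t : ℤ) (3 * t)) (hl : l ∈ Set.Icc (1 - 3 * t : ℤ) (3 * t))
    (i : ℕ) :
    (rotAB (6 * t))^[6 * t / 3 + i] (ladder k) = (rotAB (6 * t))^[6 * t / 3] (ladder l) ↔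
      (4 * t : ℤ) ∣ k + i - l := by
  obtain ⟨j, hj, hd, hm, hle⟩ := rotAB_iterate_ladder ht hk (6 * t / 3 + i)
  obtain ⟨j', hj', hd', hm', hle'⟩ := rotAB_iterate_ladder ht hl (6 * t / 3)
  have hdiv : 6 * t / 3 = 2 * t := by omega
  rw [hj, hj', ladder_injective.eq_iff]
  rw [hdiv] at hd hd' hle hle'
  push_cast at hd hd' hle hle'
  obtain ⟨h1, h2⟩ := hk
  obtain ⟨h3, h4⟩ := hl
  obtain ⟨h5, h6⟩ := hm
  obtain ⟨h7, h8⟩ := hm'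
  have key : k + i - l = (k + (2 * t + i) - j) - (l + 2 * t - j') + (j - j') := by ring
  rw [key, dvd_add_right (dvd_sub hd hd')]
  constructor
  · rintro rfl
    simp
  · intro h
    have := Int.eq_zero_of_abs_lt_dvd h (by rw [abs_lt]; constructor <;> omega)
    omega

theorem dpos_ladder_spec {t : ℕ} (ht : 1 ≤ t) {k l : ℤ}
    (hk : k ∈ Set.Icc (1 - 3 * t : ℤ) (3 * t)) (hl : l ∈ Set.Icc (1 - 3 * t : ℤ) (3 * t)) :
    1 ≤ dpos (6 * t) (ladder k) (ladder l) ∧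
      (4 * t : ℤ) ∣ k + dpos (6 * t) (ladder k) (ladder l) - l := by
  have hne : {i : ℕ | 1 ≤ i ∧ (rotAB (6 * t))^[6 * t / 3 + i] (ladder k) =
      (rotAB (6 * t))^[6 * t / 3] (ladder l)}.Nonempty := by
    obtain ⟨h1, h2⟩ := hk
    obtain ⟨h3, h4⟩ := hl
    refine ⟨(l - k + 8 * t).toNat, by omega, ?_⟩
    rw [rotAB_iterate_eq_iff ht ⟨h1, h2⟩ ⟨h3, h4⟩, Int.toNat_of_nonneg (by omega)]
    exact ⟨2, by ring⟩
  have h := Nat.sInf_mem hne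
  exact ⟨h.1, (rotAB_iterate_eq_iff ht hk hl _).1 h.2⟩

theorem dpos_ladder_le {t : ℕ} (ht : 1 ≤ t) {k l : ℤ}
    (hk : k ∈ Set.Icc (1 - 3 * t : ℤ) (3 * t)) (hl : l ∈ Set.Icc (1 - 3 * t : ℤ) (3 * t))
    {i : ℕ} (hi : 1 ≤ i) (h : (4 * t : ℤ) ∣ k + i - l) :
    dpos (6 * t) (ladder k) (ladder l) ≤ i :=
  Nat.sInf_le ⟨hi, (rotAB_iterate_eq_iff ht hk hl i).2 h⟩

theorem dpos_ladder_le_dpos {t : ℕ} (ht : 1 ≤ t) {k l k' l' : ℤ}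
    (hk : k ∈ Set.Icc (1 - 3 * t : ℤ) (3 * t)) (hl : l ∈ Set.Icc (1 - 3 * t : ℤ) (3 * t))
    (hk' : k' ∈ Set.Icc (1 - 3 * t : ℤ) (3 * t)) (hl' : l' ∈ Set.Icc (1 - 3 * t : ℤ) (3 * t))
    (h : (4 * t : ℤ) ∣ (k' - l') - (k - l)) :
    dpos (6 * t) (ladder k') (ladder l') ≤ dpos (6 * t) (ladder k) (ladder l) := by
  obtain ⟨h1, h2⟩ := dpos_ladder_spec ht hk hl
  refine dpos_ladder_le ht hk' hl' h1 ?_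
  exact (dvd_add h h2).trans (dvd_of_eq (by ring))

theorem dB_ladder {t : ℕ} {k : ℤ} (hk : k ∈ Set.Icc (1 - 3 * t : ℤ) (3 * t)) (q : ℤ) :
    dB (6 * t) (ladder k) q = dpos (6 * t) (ladder k) q :=
  if_pos (ladder_mem_SetS hk)

theorem dB_neg_ladder (n : ℕ) (k l : ℤ) :
    dB n (-ladder k) (-ladder l) = dpos n (ladder l) (ladder k) := by
  rw [dB, if_neg (neg_ladder_notMem_SetS k), neg_neg, neg_neg]

theorem muB_le_muB {n : ℕ} {A B : Set ℤ} (hA : A.Finite)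
    (h : ∀ p' ∈ B, ∃ p ∈ A, ∀ q ∈ A, ∃ q' ∈ B, dB n p' q' ≤ dB n p q) :
    muB n B ≤ muB n A := by
  apply csSup_le'
  rintro _ ⟨p', hp', rfl⟩
  obtain ⟨p, hp, hq⟩ := h p' hp'
  obtain ⟨q, hqA, hqe⟩ := Nat.sInf_mem (Set.Nonempty.image (fun q => dB n p q) ⟨p, hp⟩)
  obtain ⟨q', hq', hle⟩ := hq q hqA
  refine le_trans (Nat.sInf_le ⟨q', hq', rfl⟩) (hle.trans ?_)
  simp only at hqe
  rw [hqe]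
  exact le_csSup (hA.image _).bddAbove ⟨p, hp, rfl⟩

/-- A set of indices in `[1 - 3t, 3t]` is long-convex if it contains every interval of
length at least `4t` whose endpoints it contains. -/
def LongConvex (t : ℕ) (K : Set ℤ) : Prop :=
  K ⊆ Set.Icc (1 - 3 * t : ℤ) (3 * t) ∧
    ∀ k ∈ K, ∀ l ∈ K, k + 4 * t ≤ l → Set.Icc k l ⊆ K

theorem LongConvex.image_flipIdx {t : ℕ} (ht : 1 ≤ t) (s : Bool) {K : Set ℤ}
    (hK : LongConvex t K) : LongConvex t (flipIdx t s '' K) := by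
  obtain ⟨hsub, hconv⟩ := hK
  refine ⟨?_, ?_⟩
  · rintro _ ⟨k, hk, rfl⟩
    exact flipIdx_mem ht s (hsub hk)
  · rintro _ ⟨k, hk, rfl⟩ _ ⟨l, hl, rfl⟩ hkl x ⟨hx1, hx2⟩
    obtain ⟨hk1, hk2⟩ := hsub hk
    obtain ⟨hl1, hl2⟩ := hsub hl
    cases s <;> simp only [flipIdx, Bool.false_eq_true, if_true, if_false] at hkl hx1 hx2
    · have hx : -x ∈ K := by
        split_ifs at hkl hx1 hx2 <;>
          first
          | omega
          | exact hconv l hl k hk (by omega) ⟨by omega, by omega⟩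
      refine ⟨-x, hx, ?_⟩
      simp only [flipIdx, Bool.false_eq_true, if_false]
      split_ifs at * <;> omega
    · have hx : 1 - x ∈ K := by
        split_ifs at hkl hx1 hx2 <;>
          first
          | omega
          | exact hconv l hl k hk (by omega) ⟨by omega, by omega⟩
      refine ⟨1 - x, hx, ?_⟩
      simp only [flipIdx, if_true]
      split_ifs at * <;> omega

theorem image_Bstep_ladder {t : ℕ} (ht : 1 ≤ t) (s : Bool) {K : Set ℤ}
    (hK : K ⊆ Set.Icc (1 - 3 * t : ℤ) (3 * t)) :
    (fun q => Bstep (6 * t) q s) '' (ladder '' K) =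
      (fun k => -ladder k) '' (flipIdx t s '' K) := by
  rw [Set.image_image, Set.image_image]
  exact Set.image_congr fun k hk => Bstep_ladder ht s (hK hk)

theorem image_Bstep_neg_ladder {t : ℕ} (ht : 1 ≤ t) (s : Bool) {K : Set ℤ}
    (hK : K ⊆ Set.Icc (1 - 3 * t : ℤ) (3 * t)) :
    (fun q => Bstep (6 * t) q s) '' ((fun k => -ladder k) '' K) =
      ladder '' (flipIdx t s '' K) := by
  rw [Set.image_image, Set.image_image]
  exact Set.image_congr fun k hk => Bstep_neg_ladder ht s (hK hk)

theorem BactSet_append_singleton (n : ℕ) (A : Set ℤ) (v : List Bool) (s : Bool) :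
    BactSet n A (v ++ [s]) = (fun q => Bstep n q s) '' BactSet n A v := by
  simp [BactSet, Bact, Set.image_image]

theorem exists_longConvex_BactSet {t : ℕ} (ht : 1 ≤ t) (v : List Bool) :
    ∃ K : Set ℤ, LongConvex t K ∧
      (BactSet (6 * t) (SetS (6 * t)) v = ladder '' K ∨
        BactSet (6 * t) (SetS (6 * t)) v = (fun k => -ladder k) '' K) := by
  induction v using List.reverseRecOn with
  | nil =>
    refine ⟨Set.Icc (1 - 3 * t : ℤ) (3 * t), ⟨subset_rfl, ?_⟩, Or.inl ?_⟩
    · exact fun k hk l hl _ => Set.Icc_subset_Icc hk.1 hl.2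
    · simp [BactSet, Bact, SetS_eq_image]
  | append_singleton v s ih =>
    obtain ⟨K, hK, h⟩ := ih
    refine ⟨flipIdx t s '' K, hK.image_flipIdx ht s, ?_⟩
    rw [BactSet_append_singleton]
    rcases h with h | h
    · exact Or.inr (by rw [h, image_Bstep_ladder ht s hK.1])
    · exact Or.inl (by rw [h, image_Bstep_neg_ladder ht s hK.1])

/-- Under the symbol `b` every residue modulo `4t` of `K` is reflected to a residue of the
image, provided that `-t ∈ K` whenever `3t ∈ K`. -/
theorem exists_flipIdx_true_dvd {t : ℕ} (ht : 1 ≤ t) {K : Set ℤ}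
    (h : 3 * (t : ℤ) ∈ K → -(t : ℤ) ∈ K) {k : ℤ} (hk : k ∈ K) :
    ∃ l ∈ K, (4 * t : ℤ) ∣ flipIdx t true l - (1 - k) := by
  by_cases hkt : k = 3 * t
  · refine ⟨-t, h (hkt ▸ hk), ?_⟩
    rw [flipIdx, if_neg (by omega), hkt]
    exact ⟨1, by simp only [if_true]; ring⟩
  · refine ⟨k, hk, ?_⟩
    simp [flipIdx, hkt]

theorem muB_image_flipIdx_le_of_pos {t : ℕ} (ht : 1 ≤ t) {K : Set ℤ}
    (hK : K ⊆ Set.Icc (1 - 3 * t : ℤ) (3 * t)) (h : 3 * (t : ℤ) ∈ K → -(t : ℤ) ∈ K) :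
    muB (6 * t) ((fun k => -ladder k) '' (flipIdx t true '' K)) ≤
      muB (6 * t) (ladder '' K) := by
  have hflip : ∀ {k}, k ∈ K → flipIdx t true k ∈ Set.Icc (1 - 3 * t : ℤ) (3 * t) :=
    fun hk => flipIdx_mem ht true (hK hk)
  refine muB_le_muB (((Set.finite_Icc _ _).subset hK).image _) ?_
  rintro _ ⟨_, ⟨k, hk, rfl⟩, rfl⟩
  by_cases hex : ∃ p ∈ K, (4 * t : ℤ) ∣ flipIdx t true k - (1 - p)
  · obtain ⟨p, hp, hpd⟩ := hex
    refine ⟨_, ⟨p, hp, rfl⟩, ?_⟩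
    rintro _ ⟨q, hq, rfl⟩
    obtain ⟨l, hl, hld⟩ := exists_flipIdx_true_dvd ht h hq
    refine ⟨_, ⟨_, ⟨l, hl, rfl⟩, rfl⟩, ?_⟩
    simp only
    rw [dB_neg_ladder, dB_ladder (hK hp)]
    refine dpos_ladder_le_dpos ht (hK hp) (hK hq) (hflip hl) (hflip hk) ?_
    exact (dvd_sub hld hpd).trans (dvd_of_eq (by ring))
  · have hkt : k = 3 * t := by
      by_contra hne
      exact hex ⟨k, hk, by simp [flipIdx, hne]⟩
    subst hkt
    have ht' := h hk
    refine ⟨_, ⟨_, ht', rfl⟩, ?_⟩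
    rintro _ ⟨q, hq, rfl⟩
    obtain ⟨l, hl, hld⟩ := exists_flipIdx_true_dvd ht h hq
    refine ⟨_, ⟨_, ⟨l, hl, rfl⟩, rfl⟩, ?_⟩
    simp only
    rw [dB_neg_ladder, dB_ladder (hK ht')]
    obtain ⟨h1, h2⟩ := dpos_ladder_spec ht (hK ht') (hK hq)
    set d := dpos (6 * t) (ladder (-t)) (ladder q)
    have hval : flipIdx t true (3 * t) = t := by simp [flipIdx]
    have hd : d ≠ 1 := by
      intro hd
      refine hex ⟨q, hq, ?_⟩
      rw [hd] at h2
      rw [hval, ← dvd_neg]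
      exact h2.trans (dvd_of_eq (by push_cast; ring))
    refine (dpos_ladder_le ht (hflip hl) (hflip hk) (i := d - 1) (by omega) ?_).trans
      (Nat.sub_le _ _)
    rw [hval, Nat.cast_sub h1]
    exact (dvd_add hld h2).trans (dvd_of_eq (by push_cast; ring))

theorem muB_image_flipIdx_le_of_neg {t : ℕ} (ht : 1 ≤ t) {K : Set ℤ}
    (hK : K ⊆ Set.Icc (1 - 3 * t : ℤ) (3 * t)) (h : 3 * (t : ℤ) ∈ K → -(t : ℤ) ∈ K) :
    muB (6 * t) (ladder '' (flipIdx t true '' K)) ≤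
      muB (6 * t) ((fun k => -ladder k) '' K) := by
  have hflip : ∀ {k}, k ∈ K → flipIdx t true k ∈ Set.Icc (1 - 3 * t : ℤ) (3 * t) :=
    fun hk => flipIdx_mem ht true (hK hk)
  refine muB_le_muB (((Set.finite_Icc _ _).subset hK).image _) ?_
  rintro _ ⟨_, ⟨k, hk, rfl⟩, rfl⟩
  refine ⟨_, ⟨k, hk, rfl⟩, ?_⟩
  rintro _ ⟨q, hq, rfl⟩
  by_cases hkt : k = 3 * t
  · subst hkt
    have ht' := h hk
    refine ⟨_, ⟨_, ⟨_, ht', rfl⟩, rfl⟩, ?_⟩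
    simp only
    rw [dB_neg_ladder, dB_ladder (hflip hk)]
    refine le_trans ?_ (dpos_ladder_spec ht (hK hq) (hK hk)).1
    refine dpos_ladder_le ht (hflip hk) (hflip ht') le_rfl ⟨0, ?_⟩
    simp only [flipIdx, if_true]
    split_ifs <;> push_cast <;> omega
  · obtain ⟨l, hl, hld⟩ := exists_flipIdx_true_dvd ht h hq
    refine ⟨_, ⟨_, ⟨l, hl, rfl⟩, rfl⟩, ?_⟩
    simp only
    rw [dB_neg_ladder, dB_ladder (hflip hk)]
    refine dpos_ladder_le_dpos ht (hK hq) (hK hk) (hflip hk) (hflip hl) ?_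
    have hval : flipIdx t true k = 1 - k := by simp [flipIdx, hkt]
    rw [hval, ← dvd_neg]
    exact hld.trans (dvd_of_eq (by ring))

/-- Let `n` be divisible by 6 and let `w` be a word with `|Sw| = 1` in `ℬ_n`
of minimal switch count. If `vb` is a prefix of `w` with `μ(Svb) = μ(Sv) + 1`,
then `Sv ⊆ C` or `Sv ⊆ -C`. -/
theorem in_C_of_measure_increase (n : ℕ) (hn : 6 ∣ n) (w v : List Bool)
    (hsync : ∃ x : ℤ, BactSet n (SetS n) w = {x})
    (hminsw : ∀ u : List Bool, (∃ x : ℤ, BactSet n (SetS n) u = {x}) →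
      swc w ≤ swc u)
    (hpre : (v ++ [true]) <+: w)
    (hmu : muB n (BactSet n (SetS n) (v ++ [true])) =
      muB n (BactSet n (SetS n) v) + 1) :
    BactSet n (SetS n) v ⊆ SetC n ∨ BactSet n (SetS n) v ⊆ Neg.neg '' SetC n := by
  obtain ⟨t, rfl⟩ := hn
  have ht : 1 ≤ t := by
    by_contra h0
    obtain rfl : t = 0 := by omega
    obtain ⟨x, hx⟩ := hsync
    have hmem : x ∈ BactSet (6 * 0) (SetS (6 * 0)) w := hx ▸ rfl
    obtain ⟨q, hq, -⟩ := hmem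
    simp only [SetS, Set.mem_ofPred_eq] at hq
    omega
  obtain ⟨K, hK, hA⟩ := exists_longConvex_BactSet ht v
  by_cases hC : ∀ k ∈ K, 1 - (t : ℤ) ≤ k
  · rcases hA with hA | hA <;> rw [hA]
    · left
      rintro _ ⟨k, hk, rfl⟩
      exact ladder_mem_SetC (hK.1 hk) (hC k hk)
    · right
      rintro _ ⟨k, hk, rfl⟩
      exact ⟨_, ladder_mem_SetC (hK.1 hk) (hC k hk), rfl⟩
  · exfalso
    push Not at hC
    obtain ⟨x, hx, hxt⟩ := hC
    have h : 3 * (t : ℤ) ∈ K → -(t : ℤ) ∈ K := fun h3 =>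
      hK.2 x hx _ h3 (by omega) ⟨by omega, by omega⟩
    rw [BactSet_append_singleton] at hmu
    rcases hA with hA | hA <;> rw [hA] at hmu
    · rw [image_Bstep_ladder ht true hK.1] at hmu
      have := muB_image_flipIdx_le_of_pos ht hK.1 h
      omega
    · rw [image_Bstep_neg_ladder ht true hK.1] at hmu
      have := muB_image_flipIdx_le_of_neg ht hK.1 h
      omega
end

section
/- Let n be a prime number. Then the maximal switch count of a synchronizing cyclic automaton on n states is exactly 2n − 3: every synchronizing cyclic DFA on n states has a synchronizing word of switch count at most 2n − 3, and the Černý automaton C_n attains switch count 2n − 3. -/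
/-- The state reached from `q` after reading the word `w`. -/
def actWord {Q σ : Type*} (δ : Q → σ → Q) (q : Q) (w : List σ) : Q :=
  w.foldl δ q

/-- A word `w` is synchronizing for the DFA with transition function `δ`:
starting in any state, after processing `w` one always ends in the same state. -/
def IsSyncWord {Q σ : Type*} (δ : Q → σ → Q) (w : List σ) : Prop :=
  ∃ qs : Q, ∀ q : Q, actWord δ q w = qs

/-- The switch count of a synchronizing automaton: the minimal switch count of a
synchronizing word. -/
noncomputable def swOf {Q σ : Type*} [DecidableEq σ] (δ : Q → σ → Q) : ℕ :=
  sInf {k | ∃ w : List σ, IsSyncWord δ w ∧ swc w = k}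

/-- The minimal length of a synchronizing word. -/
noncomputable def sslOf {Q σ : Type*} (δ : Q → σ → Q) : ℕ :=
  sInf {k | ∃ w : List σ, IsSyncWord δ w ∧ w.length = k}

/-- The Černý automaton `C_n` (states renumbered to `ZMod n`): symbols are
booleans, `false` (= `a`) is the cyclic symbol `q ↦ q + 1`, and `true` (= `b`)
maps `0` to `1` and fixes every other state. -/
def cernyStep (n : ℕ) : ZMod n → Bool → ZMod n := fun q s =>
  if s then (if q = 0 then 1 else q) else q + 1

open Finset in
/-- On a cyclic group of prime order, the cross-correlation of two integer-valued functions
vanishes only if one of them is constant. -/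
theorem const_or_const_of_correlation_eq_zero {p : ℕ} [hp : Fact p.Prime] (g h : ZMod p → ℤ)
    (H : ∀ i, ∑ q, g q * h (q + i) = 0) :
    (∀ x y, g x = g y) ∨ (∀ x y, h x = h y) := by
  have hζ := Complex.isPrimitiveRoot_exp p hp.out.ne_zero
  set ζ := Complex.exp (2 * Real.pi * Complex.I / p)
  have const_of_sum (α : ZMod p → ℤ) (hα : ∑ q, (α q : ℂ) * ζ ^ q.val = 0) :
      ∀ x y, α x = α y := by
    obtain _ | k := p
    · exact absurd hp.out Nat.not_prime_zero
    · exact (hζ.sum_eq_zero_iff_forall_eq_int hp.out α).1 hα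
  set χ := AddChar.zmodChar p hζ.pow_eq_one
  have hprod : (∑ q, (g (-q) : ℂ) * χ q) * (∑ t, (h t : ℂ) * χ t) = 0 := by
    rw [← Equiv.sum_comp (Equiv.neg (ZMod p))]
    simp only [Equiv.neg_apply, neg_neg, sum_mul]
    have (q : ZMod p) : (g q : ℂ) * χ (-q) * ∑ t, (h t : ℂ) * χ t =
        ∑ i, χ i * ((g q : ℂ) * h (q + i)) := by
      rw [← Equiv.sum_comp (Equiv.addLeft q), mul_sum]
      refine sum_congr rfl fun i _ => ?_
      have hχ : χ (-q) * χ (q + i) = χ i := by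
        rw [← AddChar.map_add_eq_mul, neg_add_cancel_left]
      rw [Equiv.coe_addLeft, ← hχ]
      ring
    rw [sum_congr rfl fun q _ => this q, sum_comm]
    refine sum_eq_zero fun i _ => ?_
    rw [← mul_sum]
    exact_mod_cast mul_eq_zero_of_right _ (by exact_mod_cast H i)
  rcases mul_eq_zero.1 hprod with h0 | h0
  · refine Or.inl fun x y => ?_
    simpa using const_of_sum (fun q => g (-q)) h0 (-x) (-y)
  · exact Or.inr (const_of_sum h h0)

open Finset in
/-- If `b` is not injective on `ZMod p`, every nonempty proper subset has a translate whose
preimage under `b` is strictly larger. -/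
theorem exists_card_lt_card_preimage {p : ℕ} [hp : Fact p.Prime] (b : ZMod p → ZMod p)
    (hb : ¬ Function.Injective b) (S : Finset (ZMod p)) (hS : S.Nonempty) (hS' : S ≠ univ) :
    ∃ i, #S < #{q | b q + i ∈ S} := by
  by_contra! hle
  have card_eq (f : ZMod p → ZMod p) :
      (#{q | f q ∈ S} : ℤ) = ∑ q, if f q ∈ S then 1 else 0 := by simp
  have htranslate (x : ZMod p) : (∑ i, if x + i ∈ S then (1 : ℤ) else 0) = #S := by
    have := Equiv.sum_comp (Equiv.addLeft x) fun i => if i ∈ S then (1 : ℤ) else 0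
    exact this.trans (by simp)
  have htotal : ∑ i, #{q | b q + i ∈ S} = ∑ _i : ZMod p, #S := by
    zify
    simp only [card_eq]
    rw [sum_comm]
    exact sum_congr rfl fun q _ => htranslate (b q)
  have hall := (sum_eq_sum_iff_of_le fun i _ => hle i).1 htotal
  let g : ZMod p → ℤ := fun q => #{x | b x = q} - 1
  let h : ZMod p → ℤ := fun q => if q ∈ S then 1 else 0
  have hcorr (i : ZMod p) : ∑ q, g q * h (q + i) = 0 := by
    have hfib : ∑ q, (#{x | b x = q} : ℤ) * h (q + i) = ∑ x, h (b x + i) := by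
      rw [← sum_fiberwise univ b fun x => h (b x + i)]
      refine sum_congr rfl fun q _ => ?_
      rw [sum_congr rfl fun x hx => by rw [(mem_filter.1 hx).2], sum_const, nsmul_eq_mul]
    have hone : ∑ q, h (q + i) = #S := by
      simpa only [add_comm] using htranslate i
    simp only [g, sub_mul, one_mul, sum_sub_distrib, hfib, hone]
    rw [sub_eq_zero, ← hall i (mem_univ i), card_eq]
  rcases const_or_const_of_correlation_eq_zero g h hcorr with hg | hh
  · have hsum : ∑ q, g q = 0 := by
      have : ∑ q, #{x | b x = q} = #(univ : Finset (ZMod p)) :=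
        (card_eq_sum_card_fiberwise (by simp)).symm
      simp only [g, sum_sub_distrib]
      rw [sub_eq_zero]
      exact_mod_cast this.trans (by simp)
    have hzero (q : ZMod p) : g q = 0 := by
      rw [sum_congr rfl fun x _ => hg x q] at hsum
      simpa [hp.out.ne_zero] using hsum
    refine hb (Finite.injective_iff_surjective.2 fun q => ?_)
    have : 0 < #{x | b x = q} := by have := hzero q; simp only [g] at this; omega
    obtain ⟨x, hx⟩ := card_pos.1 this
    exact ⟨x, by simpa using hx⟩
  · obtain ⟨x, hx⟩ := hS
    refine hS' (eq_univ_of_forall fun y => ?_)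
    have := hh x y
    by_contra hy
    simp [h, hx, hy] at this

section Words

variable {Q σ : Type*}

theorem actWord_append (δ : Q → σ → Q) (q : Q) (u v : List σ) :
    actWord δ q (u ++ v) = actWord δ (actWord δ q u) v :=
  List.foldl_append

theorem injective_actWord {δ : Q → σ → Q} (h : ∀ s, Function.Injective fun q => δ q s)
    (w : List σ) : Function.Injective fun q => actWord δ q w := by
  induction w with
  | nil => exact fun _ _ h => h
  | cons s w ih => exact ih.comp (h s)

theorem actWord_conj {R : Type*} (e : Q ≃ R) (δ : Q → σ → Q) (q : Q) (w : List σ) :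
    actWord (fun r s => e (δ (e.symm r) s)) (e q) w = e (actWord δ q w) := by
  induction w generalizing q with
  | nil => rfl
  | cons s w ih => simpa [actWord] using ih (δ q s)

variable [DecidableEq σ]

theorem swc_cons_le (a : σ) (w : List σ) : swc (a :: w) ≤ swc w + 1 := by
  cases w with
  | nil => simp [swc]
  | cons b w => simp only [swc]; split <;> omega

theorem swc_replicate_append_le (a : σ) (k : ℕ) (w : List σ) :
    swc (List.replicate k a ++ w) ≤ swc w + 1 := by
  induction k with
  | zero => simp
  | succ k ih =>
    cases k with
    | zero => exact swc_cons_le a w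
    | succ k => simpa [List.replicate_succ, swc] using ih

end Words

theorem actWord_replicate_of_add_one {σ : Type*} {n : ℕ} {δ : ZMod n → σ → ZMod n} {a : σ}
    (ha : ∀ q, δ q a = q + 1) (k : ℕ) (q : ZMod n) :
    actWord δ q (List.replicate k a) = q + k := by
  induction k generalizing q with
  | zero => simp [actWord]
  | succ k ih =>
    have := ih (δ q a)
    simp only [actWord, List.replicate_succ, List.foldl_cons] at this ⊢
    rw [this, ha]
    push_cast
    ring

open Finset in
/-- A cyclic automaton with a prime number of states and a non-injective symbol has a
synchronizing word of switch count at most `2p - 3`. -/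
theorem exists_isSyncWord_swc_le {σ : Type*} [DecidableEq σ] {p : ℕ} [hp : Fact p.Prime]
    {δ : ZMod p → σ → ZMod p} {a b : σ} (ha : ∀ q, δ q a = q + 1)
    (hb : ¬ Function.Injective fun q => δ q b) :
    ∃ w, IsSyncWord δ w ∧ swc w ≤ 2 * p - 3 := by
  have key (m : ℕ) (hm : 2 ≤ m) (hmp : m ≤ p) :
      ∃ qs w, swc (b :: w) ≤ 2 * m - 3 ∧ m ≤ #{q | actWord δ q (b :: w) = qs} := by
    induction m, hm using Nat.le_induction with
    | base =>
      simp only [Function.Injective] at hb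
      push Not at hb
      obtain ⟨x, y, hxy, hne⟩ := hb
      refine ⟨δ x b, [], by simp [swc], ?_⟩
      rw [← card_pair hne]
      refine card_le_card fun z hz => mem_filter.2 ⟨mem_univ z, ?_⟩
      rcases mem_insert.1 hz with rfl | hz
      · rfl
      · obtain rfl := mem_singleton.1 hz
        exact hxy.symm
    | succ m hm ih =>
      obtain ⟨qs, w, hsw, hcard⟩ := ih (by omega)
      set S : Finset (ZMod p) := {q | actWord δ q (b :: w) = qs} with hS
      by_cases huniv : S = univ
      · refine ⟨qs, w, by omega, ?_⟩
        rw [← hS, huniv, card_univ, ZMod.card]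
        exact hmp
      · obtain ⟨i, hi⟩ := exists_card_lt_card_preimage (fun q => δ q b) hb S
          (card_pos.1 (by omega)) huniv
        refine ⟨qs, List.replicate i.val a ++ b :: w, ?_, ?_⟩
        · have h₁ := swc_cons_le b (List.replicate i.val a ++ b :: w)
          have h₂ := swc_replicate_append_le a i.val (b :: w)
          omega
        · refine (Nat.succ_le_of_lt (hcard.trans_lt hi)).trans (card_le_card fun q hq => ?_)
          simp only [hS, mem_filter, mem_univ, true_and] at hq ⊢
          rw [← hq, ← List.singleton_append, actWord_append, actWord_append,
            actWord_replicate_of_add_one ha, ZMod.natCast_zmod_val]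
          rfl
  obtain ⟨qs, w, hsw, hcard⟩ := key p hp.out.two_le le_rfl
  refine ⟨b :: w, ⟨qs, fun q => ?_⟩, hsw⟩
  have huniv : ({q | actWord δ q (b :: w) = qs} : Finset (ZMod p)) = univ :=
    eq_univ_of_card _ (le_antisymm (card_le_univ _) (by rwa [ZMod.card]))
  simpa using huniv.ge (mem_univ q)

section Cerny

variable {p : ℕ} [Fact p.Prime]

theorem cernyStep_true_true (q : ZMod p) :
    cernyStep p (cernyStep p q true) true = cernyStep p q true := by
  by_cases h : q = 0 <;> simp [cernyStep, h]

open Finset in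
theorem card_le_card_image_cernyStep_true (T : Finset (ZMod p)) :
    #T ≤ #(T.image fun q => cernyStep p q true) + 1 := by
  have hsub : T.erase 0 ⊆ T.image fun q => cernyStep p q true := fun q hq => by
    obtain ⟨hq0, hqT⟩ := mem_erase.1 hq
    exact mem_image.2 ⟨q, hqT, by simp [cernyStep, hq0]⟩
  have := card_le_card hsub
  have := pred_card_le_card_erase (s := T) (a := 0)
  omega

open Finset in
/-- In the Černý automaton, a word reduces the size of a set of states by at most its number
of `true`-blocks, which is controlled by its switch count and first symbol. -/
theorem two_mul_card_le_cerny (w : List Bool) (T : Finset (ZMod p)) :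
    2 * #T ≤ 2 * #(T.image fun q => actWord (cernyStep p) q w) + swc w +
      (if w.head? = some true then 1 else 0) := by
  induction w generalizing T with
  | nil => simp [actWord]
  | cons s w ih =>
    have himage : (T.image fun q => actWord (cernyStep p) q (s :: w)) =
        (T.image fun q => cernyStep p q s).image fun q => actWord (cernyStep p) q w := by
      rw [image_image]; rfl
    cases s with
    | false =>
      have hcard : #(T.image fun q => cernyStep p q false) = #T :=
        card_image_of_injective _ fun x y h => by simpa [cernyStep] using h
      have := ih (T.image fun q => cernyStep p q false)
      rw [← himage, hcard] at this
      rcases w with _ | ⟨_ | _, w⟩ <;> simp [swc] at this ⊢ <;> omega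
    | true =>
      have hcard := card_le_card_image_cernyStep_true T
      have hstep := ih (T.image fun q => cernyStep p q true)
      rw [← himage] at hstep
      rcases w with _ | ⟨_ | _, w⟩
      · simp [swc] at hstep ⊢; omega
      · simp [swc] at hstep ⊢; omega
      · have hidem : (T.image fun q => actWord (cernyStep p) q (true :: true :: w)) =
            T.image fun q => actWord (cernyStep p) q (true :: w) :=
          image_congr fun q _ => by simp [actWord, cernyStep_true_true]
        have := ih T
        rw [hidem]
        simpa [swc] using this

theorem le_swc_of_isSyncWord_cernyStep {w : List Bool} (hw : IsSyncWord (cernyStep p) w) :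
    2 * p - 3 ≤ swc w := by
  obtain ⟨qs, hqs⟩ := hw
  have h := two_mul_card_le_cerny w (Finset.univ : Finset (ZMod p))
  have himage : (Finset.univ.image fun q => actWord (cernyStep p) q w).card ≤ 1 :=
    Finset.card_le_one.2 (by simp [hqs])
  rw [Finset.card_univ, ZMod.card] at h
  split at h <;> omega

end Cerny

/-- For `n` prime, the maximal switch count of a synchronizing cyclic automaton
on `n` states is exactly `2n - 3`: every synchronizing DFA on `n` states having
a cyclic symbol (i.e. whose states can be numbered by `ZMod n` so that some
symbol acts as `q ↦ q + 1`) admits a synchronizing word of switch count at most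
`2n - 3`, and the Černý automaton `C_n` attains switch count `2n - 3`. -/
theorem cyclic_sw_prime (n : ℕ) (hn : n.Prime) :
    (∀ (Q : Type) [Fintype Q] (σ : Type) [Fintype σ] [DecidableEq σ]
      (δ : Q → σ → Q),
      (∃ (e : Q ≃ ZMod n) (a : σ), ∀ q : Q, δ q a = e.symm (e q + 1)) →
      (∃ w : List σ, IsSyncWord δ w) →
      ∃ w : List σ, IsSyncWord δ w ∧ swc w ≤ 2 * n - 3) ∧
    ((∃ w : List Bool, IsSyncWord (cernyStep n) w) ∧
      swOf (cernyStep n) = 2 * n - 3) := by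
  have : Fact n.Prime := ⟨hn⟩
  refine ⟨?_, ?_⟩
  · rintro Q _ σ _ _ δ ⟨e, a, ha⟩ ⟨v, qs, hv⟩
    obtain ⟨b, hb⟩ : ∃ b, ¬ Function.Injective fun q => δ q b := by
      by_contra! hinj
      have := injective_actWord hinj v ((hv (e.symm 0)).trans (hv (e.symm 1)).symm)
      simp at this
    obtain ⟨w, ⟨r, hr⟩, hw⟩ := exists_isSyncWord_swc_le
      (δ := fun r s => e (δ (e.symm r) s)) (a := a) (b := b) (fun q => by simp [ha])
      fun h => hb fun x y hxy => e.injective (h (by simpa using hxy))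
    refine ⟨w, ⟨e.symm r, fun q => ?_⟩, hw⟩
    rw [← hr (e q), actWord_conj, e.symm_apply_apply]
  · obtain ⟨w, hsync, hw⟩ := exists_isSyncWord_swc_le
      (δ := cernyStep n) (a := false) (b := true) (fun q => by simp [cernyStep])
      fun h => zero_ne_one (α := ZMod n) (h (by simp [cernyStep]))
    refine ⟨⟨w, hsync⟩, le_antisymm ?_ ?_⟩
    · have hmem : swc w ∈ {k | ∃ w, IsSyncWord (cernyStep n) w ∧ swc w = k} := ⟨w, hsync, rfl⟩
      exact (Nat.sInf_le hmem).trans hw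
    · refine le_csInf ⟨swc w, w, hsync, rfl⟩ ?_
      rintro _ ⟨u, hu, rfl⟩
      exact le_swc_of_isSyncWord_cernyStep hu
end
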